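/- arXiv:2109.03270 — 3 statements merged into one kernel-verified Lean document; each statement's English description precedes it below -/
import Mathlib

section
/- Let h_{αβ}, k_{αβ} be symmetric 2-tensors on ℝ⁴ and define P(h,k) = ¼(m^{αβ}h_{αβ})(m^{γδ}k_{γδ}) − ½m^{αβ}m^{γδ}h_{αγ}k_{βδ}. Then, expanding in the null frame, P(h,k) = −(h_{LL}k_{L̄L̄} + h_{L̄L̄}k_{LL})/8 − Σ_{C,D,C',D'∈{S₁,S₂}} δ^{CD}δ^{C'D'}(2h_{CC'}k_{DD'} − h_{CD}k_{C'D'})/4 + Σ_{C,D∈{S₁,S₂}} δ^{CD}(2h_{CL}k_{DL̄} + 2h_{CL̄}k_{DL} − h_{CD}k_{LL̄} − h_{LL̄}k_{CD})/4, where h_{UV}=h_{αβ}U^αV^β and δ^{CD} is the Kronecker delta. -/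
noncomputable section

abbrev E3 : Type := EuclideanSpace ℝ (Fin 3)

/-- The inverse Minkowski metric `diag(-1,1,1,1)`. -/
def eta (a b : Fin 4) : ℝ := if a = b then (if a = 0 then -1 else 1) else 0

/-- A spatial vector viewed as a spacetime vector. -/
def spat (s : E3) (a : Fin 4) : ℝ := Fin.cases 0 (fun i => s i) a

/-- Contraction of a 2-tensor with two (frame) vectors: `h_{UV} = h_{αβ}U^αV^β`. -/
def con2 (h : Fin 4 → Fin 4 → ℝ) (U V : Fin 4 → ℝ) : ℝ :=
  ∑ a : Fin 4, ∑ b : Fin 4, h a b * U a * V b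

/-- The weak-null quadratic form
`P(h,k) = ¼(m^{αβ}h_{αβ})(m^{γδ}k_{γδ}) - ½ m^{αβ}m^{γδ}h_{αγ}k_{βδ}`. -/
def Pform (h k : Fin 4 → Fin 4 → ℝ) : ℝ :=
  (∑ a : Fin 4, ∑ b : Fin 4, eta a b * h a b) * (∑ c : Fin 4, ∑ d : Fin 4, eta c d * k c d) / 4
  - (∑ a : Fin 4, ∑ b : Fin 4, ∑ c : Fin 4, ∑ d : Fin 4,
      eta a b * eta c d * h a c * k b d) / 2

theorem con2_symm (h : Fin 4 → Fin 4 → ℝ) (hsym : ∀ a b, h a b = h b a) (U V : Fin 4 → ℝ) :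
    con2 h U V = con2 h V U := by
  unfold con2
  rw [Finset.sum_comm]
  refine Finset.sum_congr rfl fun a _ => Finset.sum_congr rfl fun b _ => ?_
  rw [hsym b a]; ring

theorem con2_mul (h k : Fin 4 → Fin 4 → ℝ) (U V W Z : Fin 4 → ℝ) :
    con2 h U W * con2 k V Z =
      ∑ a : Fin 4, ∑ b : Fin 4, ∑ c : Fin 4, ∑ d : Fin 4,
        (U a * V b) * (W c * Z d) * h a c * k b d := by
  unfold con2
  rw [Finset.sum_mul_sum]
  refine Finset.sum_congr rfl fun a _ => Finset.sum_congr rfl fun b _ => ?_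
  rw [Finset.sum_mul_sum]
  refine Finset.sum_congr rfl fun c _ => Finset.sum_congr rfl fun d _ => ?_
  ring

theorem trace_eq (e h : Fin 4 → Fin 4 → ℝ) (c : Fin 4 → ℝ) (U V : Fin 4 → Fin 4 → ℝ)
    (he : ∀ a b, e a b = ∑ p : Fin 4, c p * (U p a * V p b)) :
    ∑ a : Fin 4, ∑ b : Fin 4, e a b * h a b = ∑ p : Fin 4, c p * con2 h (U p) (V p) := by
  simp only [he, con2, Finset.sum_mul, Finset.mul_sum]
  calc _ = ∑ a : Fin 4, ∑ p : Fin 4, ∑ b : Fin 4, c p * (U p a * V p b) * h a b :=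
        Finset.sum_congr rfl fun a _ => Finset.sum_comm
    _ = ∑ p : Fin 4, ∑ a : Fin 4, ∑ b : Fin 4, c p * (U p a * V p b) * h a b := Finset.sum_comm
    _ = _ := by
      refine Finset.sum_congr rfl fun p _ => Finset.sum_congr rfl fun a _ =>
        Finset.sum_congr rfl fun b _ => ?_
      ring

theorem inner_E3 (u v : E3) :
    (inner ℝ u v : ℝ) = u 0 * v 0 + u 1 * v 1 + u 2 * v 2 := by
  rw [PiLp.inner_apply, Fin.sum_univ_three]
  simp only [RCLike.inner_apply, conj_trivial]
  ring

theorem sum4_comm (F : Fin 4 → Fin 4 → Fin 4 → ℝ) :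
    ∑ a : Fin 4, ∑ b : Fin 4, ∑ p : Fin 4, F a b p
      = ∑ p : Fin 4, ∑ a : Fin 4, ∑ b : Fin 4, F a b p := by
  rw [Finset.sum_comm]
  rw [Finset.sum_congr rfl fun b _ => Finset.sum_comm]
  rw [Finset.sum_comm]
  exact Finset.sum_congr rfl fun p _ => Finset.sum_comm

theorem quad_eq (e h k : Fin 4 → Fin 4 → ℝ) (c : Fin 4 → ℝ) (U V : Fin 4 → Fin 4 → ℝ)
    (he : ∀ a b, e a b = ∑ p : Fin 4, c p * (U p a * V p b)) :
    ∑ a : Fin 4, ∑ b : Fin 4, ∑ i : Fin 4, ∑ j : Fin 4, e a b * e i j * h a i * k b j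
      = ∑ p : Fin 4, ∑ q : Fin 4,
        c p * c q * (con2 h (U p) (U q) * con2 k (V p) (V q)) := by
  have inner1 : ∀ a b : Fin 4,
      ∑ i : Fin 4, ∑ j : Fin 4, e a b * e i j * h a i * k b j
        = ∑ p : Fin 4, ∑ q : Fin 4, ∑ i : Fin 4, ∑ j : Fin 4,
          c p * c q * ((U p a * V p b) * (U q i * V q j) * h a i * k b j) := by
    intro a b
    simp only [he, Finset.sum_mul, Finset.mul_sum]
    rw [Finset.sum_comm (s := Finset.univ) (t := Finset.univ) (f := fun p q : Fin 4 =>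
      ∑ i : Fin 4, ∑ j : Fin 4,
        c p * c q * ((U p a * V p b) * (U q i * V q j) * h a i * k b j))]
    rw [sum4_comm]
    refine Finset.sum_congr rfl fun p _ => ?_
    rw [sum4_comm]
    refine Finset.sum_congr rfl fun q _ => Finset.sum_congr rfl fun i _ =>
      Finset.sum_congr rfl fun j _ => ?_
    ring
  simp only [inner1]
  rw [sum4_comm]
  refine Finset.sum_congr rfl fun p _ => ?_
  rw [sum4_comm]
  refine Finset.sum_congr rfl fun q _ => ?_
  rw [con2_mul]
  simp only [Finset.mul_sum]

theorem eta_frame (w s t : Fin 3 → ℝ)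
    (hww : w 0 * w 0 + w 1 * w 1 + w 2 * w 2 = 1)
    (hss : s 0 * s 0 + s 1 * s 1 + s 2 * s 2 = 1)
    (htt : t 0 * t 0 + t 1 * t 1 + t 2 * t 2 = 1)
    (hsw : s 0 * w 0 + s 1 * w 1 + s 2 * w 2 = 0)
    (htw : t 0 * w 0 + t 1 * w 1 + t 2 * w 2 = 0)
    (hst : s 0 * t 0 + s 1 * t 1 + s 2 * t 2 = 0) (i j : Fin 3) :
    w i * w j + s i * s j + t i * t j = if i = j then 1 else 0 := by
  let M : Matrix (Fin 3) (Fin 3) ℝ := Matrix.of ![w, s, t]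
  have h1 : M * M.transpose = 1 := by
    ext i j
    fin_cases i <;> fin_cases j <;>
      simp [M, Matrix.mul_apply, Fin.sum_univ_three] <;> linarith
  have h2 : M.transpose * M = 1 := mul_eq_one_comm.mp h1
  have h3 := congrFun (congrFun h2 i) j
  simpa [M, Matrix.mul_apply, Fin.sum_univ_three, Matrix.one_apply] using h3

/-- **Null-frame expansion of `P`** (identity (eq:nullframeP)).  At a point `x ≠ 0`, with
`L = (1,ω)`, `L̄ = (1,-ω)` and `S₁,S₂` an orthonormal tangent pair, for symmetric `h,k`:
`P(h,k) = -(h_{LL}k_{L̄L̄}+h_{L̄L̄}k_{LL})/8 - δ^{CD}δ^{C'D'}(2h_{CC'}k_{DD'}-h_{CD}k_{C'D'})/4`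
`+ δ^{CD}(2h_{CL}k_{DL̄}+2h_{CL̄}k_{DL}-h_{CD}k_{LL̄}-h_{LL̄}k_{CD})/4`. -/
theorem nullframe_expansion_P
    (x : E3) (hx : x ≠ 0)
    (S : Fin 2 → E3)
    (hSortho : ∀ A B : Fin 2, (inner ℝ (S A) (S B) : ℝ) = if A = B then 1 else 0)
    (hStan : ∀ A : Fin 2, (inner ℝ (S A) x : ℝ) = 0)
    (h k : Fin 4 → Fin 4 → ℝ)
    (hsym : ∀ a b, h a b = h b a) (ksym : ∀ a b, k a b = k b a) :
    Pform h k =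
      -(con2 h (fun a => Fin.cases 1 (fun i => (‖x‖⁻¹ • x : E3) i) a)
            (fun a => Fin.cases 1 (fun i => (‖x‖⁻¹ • x : E3) i) a)
          * con2 k (fun a => Fin.cases 1 (fun i => -(‖x‖⁻¹ • x : E3) i) a)
            (fun a => Fin.cases 1 (fun i => -(‖x‖⁻¹ • x : E3) i) a)
        + con2 h (fun a => Fin.cases 1 (fun i => -(‖x‖⁻¹ • x : E3) i) a)
            (fun a => Fin.cases 1 (fun i => -(‖x‖⁻¹ • x : E3) i) a)
          * con2 k (fun a => Fin.cases 1 (fun i => (‖x‖⁻¹ • x : E3) i) a)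
            (fun a => Fin.cases 1 (fun i => (‖x‖⁻¹ • x : E3) i) a)) / 8
      - (∑ C : Fin 2, ∑ D : Fin 2, ∑ C' : Fin 2, ∑ D' : Fin 2,
          (if C = D then (1:ℝ) else 0) * (if C' = D' then (1:ℝ) else 0) *
            (2 * con2 h (spat (S C)) (spat (S C')) * con2 k (spat (S D)) (spat (S D'))
              - con2 h (spat (S C)) (spat (S D)) * con2 k (spat (S C')) (spat (S D')))) / 4
      + (∑ C : Fin 2, ∑ D : Fin 2,
          (if C = D then (1:ℝ) else 0) *
            (2 * con2 h (spat (S C)) (fun a => Fin.cases 1 (fun i => (‖x‖⁻¹ • x : E3) i) a)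
                * con2 k (spat (S D)) (fun a => Fin.cases 1 (fun i => -(‖x‖⁻¹ • x : E3) i) a)
              + 2 * con2 h (spat (S C)) (fun a => Fin.cases 1 (fun i => -(‖x‖⁻¹ • x : E3) i) a)
                * con2 k (spat (S D)) (fun a => Fin.cases 1 (fun i => (‖x‖⁻¹ • x : E3) i) a)
              - con2 h (spat (S C)) (spat (S D))
                * con2 k (fun a => Fin.cases 1 (fun i => (‖x‖⁻¹ • x : E3) i) a)
                    (fun a => Fin.cases 1 (fun i => -(‖x‖⁻¹ • x : E3) i) a)
              - con2 h (fun a => Fin.cases 1 (fun i => (‖x‖⁻¹ • x : E3) i) a)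
                    (fun a => Fin.cases 1 (fun i => -(‖x‖⁻¹ • x : E3) i) a)
                * con2 k (spat (S C)) (spat (S D)))) / 4 := by
  have hn : ‖x‖ ≠ 0 := norm_ne_zero_iff.mpr hx
  have hww : (inner ℝ (‖x‖⁻¹ • x : E3) (‖x‖⁻¹ • x : E3) : ℝ) = 1 := by
    rw [real_inner_self_eq_norm_sq, norm_smul, norm_inv, norm_norm, inv_mul_cancel₀ hn, one_pow]
  have hsw : ∀ A, (inner ℝ (S A) (‖x‖⁻¹ • x : E3) : ℝ) = 0 := by
    intro A
    rw [real_inner_smul_right, hStan, mul_zero]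
  generalize (‖x‖⁻¹ • x : E3) = w at hww hsw ⊢
  have h00 := hSortho 0 0
  have h11 := hSortho 1 1
  have h01 := hSortho 0 1
  have h0w := hsw 0
  have h1w := hsw 1
  simp only [inner_E3] at hww h00 h11 h01 h0w h1w
  norm_num at h01
  simp only [if_true] at h00 h11
  have fr := eta_frame w (S 0) (S 1) (by linarith) (by linarith) (by linarith) (by linarith)
    (by linarith) (by linarith)
  set L : Fin 4 → ℝ := fun a => Fin.cases 1 (fun i => w i) a with hL
  set N : Fin 4 → ℝ := fun a => Fin.cases 1 (fun i => -w i) a with hN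
  have he : ∀ a b, eta a b = ∑ p : Fin 4, (![-1/2, -1/2, 1, 1] : Fin 4 → ℝ) p *
      ((![L, N, spat (S 0), spat (S 1)] : Fin 4 → Fin 4 → ℝ) p a *
        (![N, L, spat (S 0), spat (S 1)] : Fin 4 → Fin 4 → ℝ) p b) := by
    intro a b
    refine Fin.cases ?_ (fun i => ?_) a <;> refine Fin.cases ?_ (fun j => ?_) b
    · simp [eta, Fin.sum_univ_four, hL, hN, spat]
    · simp [eta, Fin.sum_univ_four, hL, hN, spat, (Fin.succ_ne_zero j).symm]
    · simp [eta, Fin.sum_univ_four, hL, hN, spat]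
    · have := fr i j
      simp [eta, Fin.sum_univ_four, hL, hN, spat]
      rw [← this]; ring
  unfold Pform
  rw [trace_eq eta h _ _ _ he, trace_eq eta k _ _ _ he, quad_eq eta h k _ _ _ he]
  simp only [Fin.sum_univ_four, Fin.sum_univ_two]
  simp
  rw [con2_symm h hsym N L, con2_symm k ksym N L]
  simp only [con2_symm h hsym L (spat _), con2_symm h hsym N (spat _),
    con2_symm k ksym L (spat _), con2_symm k ksym N (spat _)]
  ring
end
end

section
/- Let P(h,k) = ¼(m^{αβ}h_{αβ})(m^{γδ}k_{γδ}) − ½m^{αβ}m^{γδ}h_{αγ}k_{βδ} for symmetric 2-tensors h,k, and let P_𝒮(h,k) = −½ Σ_{A,B∈{S₁,S₂}} ĥ_{AB}k̂_{AB} with ĥ_{AB}=h_{AB}−½δ_{AB}tr̸h. Then there is an absolute constant C such that: (i) for symmetric-2-tensor-valued C¹ functions h,k on ℝ^{1+3} and all μ,ν: |P(∂_μh, ∂_νk) − L_μL_ν P(∂_qh, ∂_qk)| ≤ C(|∂̄h||∂k| + |∂h||∂̄k|), where ∂_μh denotes the 2-tensor with components ∂_μh_{αβ}, ∂_q=(∂_r−∂_t)/2,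 and L_μ=m_{μν}L^ν; and (ii) pointwise for symmetric 2-tensors h,k: |P(h,k) − P_𝒮(h,k)| ≤ C((|h|_{L𝒯}+|tr̸h|)|k| + |h|(|k|_{L𝒯}+|tr̸k|)). -/
noncomputable section
open MeasureTheory

abbrev Spt : Type := ℝ × E3

/-- The coordinate basis directions of `ℝ^{1+3}`. -/
def dir (a : Fin 4) : Spt :=
  Fin.cases ((1:ℝ), (0:E3)) (fun i => ((0:ℝ), EuclideanSpace.single i (1:ℝ))) a

/-- Coordinate partial derivative `∂_a`. -/
def pd (a : Fin 4) (f : Spt → ℝ) (p : Spt) : ℝ := fderiv ℝ f p (dir a)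

def toVec (c : Fin 4 → ℝ) : Spt := ∑ a : Fin 4, c a • dir a

/-- The japanese bracket `⟨s⟩ = 1 + |s|`. -/
def jap (s : ℝ) : ℝ := 1 + |s|

/-- ω = x/|x| -/
def omg (p : Spt) : E3 := ‖p.2‖⁻¹ • p.2

def Ldir (p : Spt) : Spt := ((1:ℝ), omg p)
def Lbardir (p : Spt) : Spt := ((1:ℝ), -omg p)
def qdir (p : Spt) : Spt := (-(1:ℝ)/2, (2⁻¹:ℝ) • omg p)
def angDir (i : Fin 3) (p : Spt) : Spt :=
  ((0:ℝ), EuclideanSpace.single i (1:ℝ) - omg p i • omg p)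

def Llow (p : Spt) (a : Fin 4) : ℝ := Fin.cases (-1:ℝ) (fun i => omg p i) a
def Lup (p : Spt) (a : Fin 4) : ℝ := Fin.cases (1:ℝ) (fun i => omg p i) a
def Lbarlow (p : Spt) (a : Fin 4) : ℝ := Fin.cases (-1:ℝ) (fun i => -omg p i) a
def Lbarup (p : Spt) (a : Fin 4) : ℝ := Fin.cases (1:ℝ) (fun i => -omg p i) a

/-- Index type for the Minkowski commuting vector fields: translations,
rotations/boosts, scaling. -/
abbrev ZIdx : Type := Fin 4 ⊕ (Fin 4 × Fin 4) ⊕ Unit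

def xlow (p : Spt) (a : Fin 4) : ℝ := Fin.cases (-p.1) (fun i => p.2 i) a
def xup (p : Spt) (a : Fin 4) : ℝ := Fin.cases p.1 (fun i => p.2 i) a

/-- The components of the Minkowski commuting vector fields. -/
def zfield : ZIdx → Spt → Fin 4 → ℝ
  | Sum.inl a => fun _ c => if c = a then 1 else 0
  | Sum.inr (Sum.inl ab) => fun p c =>
      xlow p ab.1 * (if c = ab.2 then 1 else 0) - xlow p ab.2 * (if c = ab.1 then 1 else 0)
  | Sum.inr (Sum.inr _) => fun p => xup p

/-- `Z^I` applied to a scalar function. -/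
def zApply : {k : ℕ} → (Fin k → ZIdx) → (Spt → ℝ) → Spt → ℝ
  | 0, _, f => f
  | _+1, I, f => fun p => fderiv ℝ (zApply (fun j => I j.succ) f) p (toVec (zfield (I 0) p))

/-- `∂^β` applied to a scalar function. -/
def pdT : {k : ℕ} → (Fin k → Fin 4) → (Spt → ℝ) → Spt → ℝ
  | 0, _, f => f
  | _+1, β, f => pd (β 0) (pdT (fun j => β j.succ) f)

def pdd (a b : Fin 4) (f : Spt → ℝ) : Spt → ℝ := pd a (pd b f)

/-- The flat wave operator `□ = -∂_t² + Δ`. -/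
def box (f : Spt → ℝ) (p : Spt) : ℝ := -(pdd 0 0 f p) + ∑ i : Fin 3, pdd i.succ i.succ f p


/-- The matrix of `μ`-derivatives `(∂_μ h)_{αβ}` of a 2-tensor field, in direction `v`. -/
def derMat (h : Spt → Fin 4 → Fin 4 → ℝ) (p : Spt) (v : Spt) (a b : Fin 4) : ℝ :=
  fderiv ℝ (fun q => h q a b) p v

/-- `|∂h|`: sum of all coordinate derivatives of all components. -/
def nD2 (h : Spt → Fin 4 → Fin 4 → ℝ) (p : Spt) : ℝ :=
  ∑ c : Fin 4, ∑ a : Fin 4, ∑ b : Fin 4, |derMat h p (dir c) a b|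

/-- `|∂̄h|`: tangential derivatives of all components. -/
def nT2 (h : Spt → Fin 4 → Fin 4 → ℝ) (p : Spt) : ℝ :=
  ∑ a : Fin 4, ∑ b : Fin 4,
    (|derMat h p (Ldir p) a b| + ∑ i : Fin 3, |derMat h p (angDir i p) a b|)

/-- `tr̸h` with respect to an orthonormal tangent pair `S`. -/
def trS (S : Fin 2 → E3) (h : Fin 4 → Fin 4 → ℝ) : ℝ :=
  ∑ A : Fin 2, con2 h (spat (S A)) (spat (S A))

/-- The traceless spherical part `ĥ_{AB}`. -/
def hatS (S : Fin 2 → E3) (h : Fin 4 → Fin 4 → ℝ) (A B : Fin 2) : ℝ :=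
  con2 h (spat (S A)) (spat (S B)) - (if A = B then (1:ℝ) else 0) * trS S h / 2

/-- `P_𝒮(h,k) = -½ Σ ĥ_{AB}k̂_{AB}`. -/
def PS (S : Fin 2 → E3) (h k : Fin 4 → Fin 4 → ℝ) : ℝ :=
  -(1/2) * ∑ A : Fin 2, ∑ B : Fin 2, hatS S h A B * hatS S k A B

/-- Sum of absolute values of all entries. -/
def nMat (A : Fin 4 → Fin 4 → ℝ) : ℝ := ∑ a : Fin 4, ∑ b : Fin 4, |A a b|

lemma abs_entry_le_nMat (A : Fin 4 → Fin 4 → ℝ) (a b : Fin 4) : |A a b| ≤ nMat A := by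
  have h1 : |A a b| ≤ ∑ b : Fin 4, |A a b| :=
    Finset.single_le_sum (f := fun b => |A a b|) (fun _ _ => abs_nonneg _) (Finset.mem_univ b)
  have h2 : (∑ b : Fin 4, |A a b|) ≤ nMat A :=
    Finset.single_le_sum (f := fun a => ∑ b : Fin 4, |A a b|)
      (fun _ _ => Finset.sum_nonneg fun _ _ => abs_nonneg _) (Finset.mem_univ a)
  exact h1.trans h2

lemma nMat_nonneg (A : Fin 4 → Fin 4 → ℝ) : 0 ≤ nMat A :=
  Finset.sum_nonneg fun _ _ => Finset.sum_nonneg fun _ _ => abs_nonneg _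

/-- The sign of the diagonal of `eta`. -/
def sg (a : Fin 4) : ℝ := if a = 0 then -1 else 1

lemma abs_sg (a : Fin 4) : |sg a| = 1 := by
  unfold sg; split_ifs <;> simp

lemma Pform_eq (h k : Fin 4 → Fin 4 → ℝ) :
    Pform h k = (∑ a : Fin 4, sg a * h a a) * (∑ c : Fin 4, sg c * k c c) / 4
      - (∑ a : Fin 4, ∑ c : Fin 4, sg a * sg c * h a c * k a c) / 2 := by
  have e : ∀ a b, eta a b = if a = b then sg a else 0 := fun a b => by simp [eta, sg]
  unfold Pform
  simp only [e, ite_mul, mul_ite, zero_mul, mul_zero, Finset.sum_ite_eq,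
    Finset.mem_univ, if_true]
  congr 2
  refine Finset.sum_congr rfl fun a _ => ?_
  simp [Finset.sum_ite_eq]

lemma abs_tr_le (h : Fin 4 → Fin 4 → ℝ) : |∑ a : Fin 4, sg a * h a a| ≤ nMat h := by
  refine (Finset.abs_sum_le_sum_abs _ _).trans (Finset.sum_le_sum fun a _ => ?_)
  rw [abs_mul, abs_sg, one_mul]
  exact Finset.single_le_sum (f := fun b => |h a b|) (fun _ _ => abs_nonneg _) (Finset.mem_univ a)

lemma abs_Pform_le (h k : Fin 4 → Fin 4 → ℝ) : |Pform h k| ≤ nMat h * nMat k := by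
  have h1 := abs_tr_le h
  have h2 := abs_tr_le k
  have h3 : |∑ a : Fin 4, ∑ c : Fin 4, sg a * sg c * h a c * k a c| ≤ nMat h * nMat k := by
    have : nMat h * nMat k = ∑ a : Fin 4, ∑ c : Fin 4, |h a c| * nMat k := by
      conv_lhs => rw [nMat]
      simp only [Finset.sum_mul]
    rw [this]
    refine (Finset.abs_sum_le_sum_abs _ _).trans (Finset.sum_le_sum fun a _ => ?_)
    refine (Finset.abs_sum_le_sum_abs _ _).trans (Finset.sum_le_sum fun c _ => ?_)
    rw [abs_mul, abs_mul, abs_mul, abs_sg, abs_sg, one_mul, one_mul]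
    exact mul_le_mul_of_nonneg_left (abs_entry_le_nMat k a c) (abs_nonneg _)
  rw [Pform_eq]
  have h4 : |(∑ a : Fin 4, sg a * h a a) * (∑ c : Fin 4, sg c * k c c)| ≤ nMat h * nMat k := by
    rw [abs_mul]
    exact mul_le_mul h1 h2 (abs_nonneg _) (nMat_nonneg h)
  have h5 := mul_nonneg (nMat_nonneg h) (nMat_nonneg k)
  rw [abs_le] at *
  constructor <;> linarith [h3.1, h3.2, h4.1, h4.2]

lemma Pform_split (A Q A' Q' B B' : Fin 4 → Fin 4 → ℝ) (l l' : ℝ)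
    (hB : ∀ a b, B a b = A a b + l * Q a b) (hB' : ∀ a b, B' a b = A' a b + l' * Q' a b) :
    Pform B B' - l * l' * Pform Q Q' = Pform A B' + l * Pform Q A' := by
  simp only [Pform_eq, Fin.sum_univ_four, hB, hB']
  ring

/-- The tangential part of `dir μ`. -/
def tdir (p : Spt) (μ : Fin 4) : Spt :=
  Fin.cases ((2⁻¹ : ℝ) • Ldir p) (fun i => angDir i p + (omg p i / 2) • Ldir p) μ

lemma dir_split (p : Spt) (μ : Fin 4) : dir μ = tdir p μ + Llow p μ • qdir p := by
  refine Fin.cases ?_ (fun i => ?_) μ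
  · simp only [dir, tdir, Llow, qdir, Ldir, Fin.cases_zero]
    refine Prod.ext ?_ ?_
    · simp; norm_num
    · simp
  · simp only [dir, tdir, Llow, qdir, Ldir, angDir, Fin.cases_succ]
    refine Prod.ext ?_ ?_
    · simp; ring
    · simp only [Prod.snd_add, Prod.smul_snd]
      module

lemma qdir_eq (p : Spt) : qdir p = (-(1/2):ℝ) • dir 0 + ∑ i : Fin 3, (omg p i / 2) • dir i.succ := by
  simp only [dir, Fin.cases_zero, Fin.cases_succ, qdir]
  refine Prod.ext ?_ ?_
  · simp [Prod.fst_sum]; norm_num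
  · ext j
    fin_cases j <;> simp [Prod.snd_sum, Fin.sum_univ_three] <;> ring

lemma norm_omg (p : Spt) (hp : p.2 ≠ 0) : ‖omg p‖ = 1 := by
  simp [omg, norm_smul, inv_mul_cancel₀ (norm_ne_zero_iff.mpr hp)]

lemma abs_omg_le (p : Spt) (hp : p.2 ≠ 0) (i : Fin 3) : |omg p i| ≤ 1 := by
  have := PiLp.norm_apply_le (omg p) i
  rwa [norm_omg p hp, Real.norm_eq_abs] at this

lemma abs_Llow_le (p : Spt) (hp : p.2 ≠ 0) (μ : Fin 4) : |Llow p μ| ≤ 1 := by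
  refine Fin.cases ?_ (fun i => ?_) μ
  · simp [Llow]
  · simpa [Llow] using abs_omg_le p hp i

lemma nMat_dir_le (h : Spt → Fin 4 → Fin 4 → ℝ) (p : Spt) (μ : Fin 4) :
    nMat (derMat h p (dir μ)) ≤ nD2 h p :=
  Finset.single_le_sum (f := fun c => nMat (derMat h p (dir c)))
    (fun _ _ => nMat_nonneg _) (Finset.mem_univ μ)

lemma nMat_qdir_le (h : Spt → Fin 4 → Fin 4 → ℝ) (p : Spt) (hp : p.2 ≠ 0) :
    nMat (derMat h p (qdir p)) ≤ nD2 h p := by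
  have : nD2 h p = ∑ a : Fin 4, ∑ b : Fin 4, ∑ c : Fin 4, |derMat h p (dir c) a b| := by
    unfold nD2
    rw [Finset.sum_comm]
    exact Finset.sum_congr rfl fun a _ => Finset.sum_comm
  rw [this]
  refine Finset.sum_le_sum fun a _ => Finset.sum_le_sum fun b _ => ?_
  rw [Fin.sum_univ_succ]
  have e : derMat h p (qdir p) a b = (-(1/2):ℝ) * derMat h p (dir 0) a b
      + ∑ i : Fin 3, (omg p i / 2) * derMat h p (dir i.succ) a b := by
    simp only [derMat]
    rw [qdir_eq, map_add, map_smul, map_sum]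
    simp only [map_smul, smul_eq_mul]
  rw [e]
  refine (abs_add_le _ _).trans (add_le_add ?_ ?_)
  · rw [abs_mul]
    have : |(-(1/2):ℝ)| ≤ 1 := by norm_num [abs_of_pos]
    exact mul_le_of_le_one_left (abs_nonneg _) this
  · refine (Finset.abs_sum_le_sum_abs _ _).trans (Finset.sum_le_sum fun i _ => ?_)
    rw [abs_mul]
    have h1 := abs_omg_le p hp i
    refine mul_le_of_le_one_left (abs_nonneg _) ?_
    rw [abs_le] at *
    constructor <;> linarith [h1.1, h1.2]

lemma nMat_tdir_le (h : Spt → Fin 4 → Fin 4 → ℝ) (p : Spt) (hp : p.2 ≠ 0) (μ : Fin 4) :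
    nMat (derMat h p (tdir p μ)) ≤ nT2 h p := by
  refine Finset.sum_le_sum fun a _ => Finset.sum_le_sum fun b _ => ?_
  have hs : 0 ≤ ∑ i : Fin 3, |derMat h p (angDir i p) a b| :=
    Finset.sum_nonneg fun _ _ => abs_nonneg _
  have hL := abs_nonneg (derMat h p (Ldir p) a b)
  refine Fin.cases ?_ (fun i => ?_) μ
  · have e : derMat h p (tdir p 0) a b = 2⁻¹ * derMat h p (Ldir p) a b := by
      simp only [derMat, tdir, Fin.cases_zero, map_smul, smul_eq_mul]
    rw [e, abs_mul]
    have : |(2⁻¹:ℝ)| = 2⁻¹ := by norm_num [abs_of_pos]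
    rw [this]
    linarith
  · have e : derMat h p (tdir p i.succ) a b = derMat h p (angDir i p) a b
        + omg p i / 2 * derMat h p (Ldir p) a b := by
      simp only [derMat, tdir, Fin.cases_succ, map_add, map_smul, smul_eq_mul]
    rw [e, add_comm |derMat h p (Ldir p) a b|]
    refine (abs_add_le _ _).trans (add_le_add ?_ ?_)
    · exact Finset.single_le_sum (f := fun i => |derMat h p (angDir i p) a b|)
        (fun _ _ => abs_nonneg _) (Finset.mem_univ i)
    · rw [abs_mul]
      have h1 := abs_omg_le p hp i
      refine mul_le_of_le_one_left (abs_nonneg _) ?_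
      rw [abs_le] at *
      constructor <;> linarith [h1.1, h1.2]

lemma part_one (h k : Spt → Fin 4 → Fin 4 → ℝ) (p : Spt) (hp : p.2 ≠ 0) (μ ν : Fin 4) :
    |Pform (derMat h p (dir μ)) (derMat k p (dir ν))
        - Llow p μ * Llow p ν * Pform (derMat h p (qdir p)) (derMat k p (qdir p))|
      ≤ nT2 h p * nD2 k p + nD2 h p * nT2 k p := by
  have e : ∀ (f : Spt → Fin 4 → Fin 4 → ℝ) (κ a b : Fin 4), derMat f p (dir κ) a b
      = derMat f p (tdir p κ) a b + Llow p κ * derMat f p (qdir p) a b := by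
    intro f κ a b
    simp only [derMat]
    conv_lhs => rw [dir_split p κ]
    rw [map_add, map_smul, smul_eq_mul]
  rw [Pform_split _ _ _ _ _ _ _ _ (e h μ) (e k ν)]
  refine (abs_add_le _ _).trans (add_le_add ?_ ?_)
  · refine (abs_Pform_le _ _).trans ?_
    exact mul_le_mul (nMat_tdir_le h p hp μ) (nMat_dir_le k p ν) (nMat_nonneg _)
      ((nMat_nonneg _).trans (nMat_tdir_le h p hp μ))
  · rw [abs_mul]
    refine (mul_le_of_le_one_left (abs_nonneg _) (abs_Llow_le p hp μ)).trans ?_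
    refine (abs_Pform_le _ _).trans ?_
    exact mul_le_mul (nMat_qdir_le h p hp) (nMat_tdir_le k p hp ν) (nMat_nonneg _)
      ((nMat_nonneg _).trans (nMat_qdir_le h p hp))

lemma con2_comm (h : Fin 4 → Fin 4 → ℝ) (hs : ∀ a b, h a b = h b a) (U V : Fin 4 → ℝ) :
    con2 h U V = con2 h V U := by
  unfold con2
  rw [Finset.sum_comm]
  refine Finset.sum_congr rfl fun a _ => Finset.sum_congr rfl fun b _ => ?_
  rw [hs b a]; ring

lemma dyad (h k : Fin 4 → Fin 4 → ℝ) (X Y Z W : Fin 4 → ℝ) :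
    ∑ a : Fin 4, ∑ b : Fin 4, ∑ c : Fin 4, ∑ d : Fin 4,
      (X a * Y b) * (Z c * W d) * h a c * k b d = con2 h X Z * con2 k Y W := by
  simp only [con2, Finset.sum_mul, Finset.mul_sum]
  simp only [← Fintype.sum_prod_type']
  refine Fintype.sum_equiv
    ⟨fun z => (z.2.1, z.2.2.2, z.1, z.2.2.1), fun z => (z.2.2.1, z.1, z.2.2.2, z.2.1),
      fun _ => rfl, fun _ => rfl⟩ _ _ fun z => ?_
  simp only [Equiv.coe_fn_mk]
  ring

lemma Pform_frame (h k : Fin 4 → Fin 4 → ℝ) (hs : ∀ a b, h a b = h b a)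
    (ks : ∀ a b, k a b = k b a) (L M X Y : Fin 4 → ℝ)
    (he : ∀ a b, eta a b = -(1/2) * (L a * M b) + -(1/2) * (M a * L b) + X a * X b + Y a * Y b) :
    Pform h k = (con2 h X X + con2 h Y Y - con2 h L M) * (con2 k X X + con2 k Y Y - con2 k L M) / 4
      - ((con2 h L L * con2 k M M + con2 h M M * con2 k L L) / 4 + con2 h L M * con2 k L M / 2
        - (con2 h L X * con2 k M X + con2 h M X * con2 k L X
          + con2 h L Y * con2 k M Y + con2 h M Y * con2 k L Y)
        + con2 h X X * con2 k X X + 2 * (con2 h X Y * con2 k X Y) + con2 h Y Y * con2 k Y Y) / 2 := by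
  have tr : ∀ f : Fin 4 → Fin 4 → ℝ, (∀ a b, f a b = f b a) →
      ∑ a : Fin 4, ∑ b : Fin 4, eta a b * f a b = con2 f X X + con2 f Y Y - con2 f L M := by
    intro f hf
    have : con2 f L M = (1/2) * con2 f L M + (1/2) * con2 f M L := by
      rw [con2_comm f hf M L]; ring
    rw [this]
    simp only [con2, Finset.mul_sum, ← Finset.sum_add_distrib, ← Finset.sum_sub_distrib]
    refine Finset.sum_congr rfl fun a _ => Finset.sum_congr rfl fun b _ => ?_
    rw [he]; ring
  have key : ∑ a : Fin 4, ∑ b : Fin 4, ∑ c : Fin 4, ∑ d : Fin 4,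
      eta a b * eta c d * h a c * k b d =
      ∑ i : Fin 4, ∑ j : Fin 4, ![-(1/2), -(1/2), 1, 1] i * ![-(1/2), -(1/2), 1, 1] j *
        (con2 h (![L, M, X, Y] i) (![L, M, X, Y] j) * con2 k (![M, L, X, Y] i) (![M, L, X, Y] j)) := by
    have q : ∀ a b : Fin 4, eta a b = ∑ i : Fin 4, ![(-(1/2) : ℝ), -(1/2), 1, 1] i *
        (![L, M, X, Y] i a * ![M, L, X, Y] i b) := by
      intro a b
      rw [he, Fin.sum_univ_four]
      simp
    generalize ![(-(1/2) : ℝ), -(1/2), 1, 1] = c at q ⊢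
    generalize ![L, M, X, Y] = U at q ⊢
    generalize ![M, L, X, Y] = V at q ⊢
    simp only [← dyad, q]
    simp only [Finset.sum_mul, Finset.mul_sum]
    simp only [← Fintype.sum_prod_type']
    refine Fintype.sum_equiv
      ⟨fun z => (z.2.2.2.2.2, z.2.2.2.2.1, z.1, z.2.1, z.2.2.1, z.2.2.2.1),
       fun z => (z.2.2.1, z.2.2.2.1, z.2.2.2.2.1, z.2.2.2.2.2, z.2.1, z.1),
       fun _ => rfl, fun _ => rfl⟩ _ _ fun z => ?_
    simp only [Equiv.coe_fn_mk]
    ring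
  unfold Pform
  rw [tr h hs, tr k ks, key]
  simp only [Fin.sum_univ_four]
  simp
  rw [con2_comm h hs M L, con2_comm k ks M L, con2_comm h hs X L, con2_comm k ks X L,
    con2_comm h hs X M, con2_comm k ks X M, con2_comm h hs Y L, con2_comm k ks Y L,
    con2_comm h hs Y M, con2_comm k ks Y M, con2_comm h hs Y X, con2_comm k ks Y X]
  ring

lemma spat_complete (w s t : E3) (hww : inner ℝ w w = (1:ℝ)) (hss : inner ℝ s s = (1:ℝ))
    (htt : inner ℝ t t = (1:ℝ)) (hst : inner ℝ s t = (0:ℝ)) (hsw : inner ℝ s w = (0:ℝ))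
    (htw : inner ℝ t w = (0:ℝ)) (i j : Fin 3) :
    w i * w j + s i * s j + t i * t j = if i = j then 1 else 0 := by
  let A : Matrix (Fin 3) (Fin 3) ℝ := Matrix.of ![fun i => w i, fun i => s i, fun i => t i]
  simp only [PiLp.inner_apply, Fin.sum_univ_three, RCLike.inner_apply, conj_trivial] at *
  have h1 : A * A.transpose = 1 := by
    ext a b
    fin_cases a <;> fin_cases b <;>
      simp [A, Matrix.mul_apply, Fin.sum_univ_three] <;> linarith
  have h2 : A.transpose * A = 1 := mul_eq_one_comm.mp h1
  have h3 := congrFun (congrFun h2 i) j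
  rw [Matrix.mul_apply, Fin.sum_univ_three, Matrix.one_apply] at h3
  simpa [A] using h3

lemma eta_frame_s18 (x : E3) (hx : x ≠ 0) (S : Fin 2 → E3)
    (hS : ∀ A B : Fin 2, (inner ℝ (S A) (S B) : ℝ) = if A = B then 1 else 0)
    (hSx : ∀ A : Fin 2, (inner ℝ (S A) x : ℝ) = 0) (a b : Fin 4) :
    eta a b = -(1/2) * (Lup ((0:ℝ), x) a * Lbarup ((0:ℝ), x) b)
      + -(1/2) * (Lbarup ((0:ℝ), x) a * Lup ((0:ℝ), x) b)
      + spat (S 0) a * spat (S 0) b + spat (S 1) a * spat (S 1) b := by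
  have hw : inner ℝ (omg ((0:ℝ), x)) (omg ((0:ℝ), x)) = (1:ℝ) := by
    rw [real_inner_self_eq_norm_sq, norm_omg _ hx]; norm_num
  have hSw : ∀ A, inner ℝ (S A) (omg ((0:ℝ), x)) = (0:ℝ) := by
    intro A
    simp [omg, inner_smul_right, hSx A]
  have c := spat_complete (omg ((0:ℝ), x)) (S 0) (S 1) hw ((hS 0 0).trans (by simp)) ((hS 1 1).trans (by simp))
    ((hS 0 1).trans (by simp)) (hSw 0) (hSw 1)
  refine Fin.cases ?_ (fun i => ?_) a
  · refine Fin.cases ?_ (fun j => ?_) b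
    · simp [eta, Lup, Lbarup, spat]; norm_num
    · simp [eta, Lup, Lbarup, spat, (Fin.succ_ne_zero j).symm]
  · refine Fin.cases ?_ (fun j => ?_) b
    · simp [eta, Lup, Lbarup, spat]
    · have := c i j
      simp only [eta, Lup, Lbarup, spat, Fin.cases_succ, Fin.succ_ne_zero, if_false, Fin.succ_inj]
      rw [← this]; ring

lemma abs_mul_le_of {x y G N : ℝ} (hx : |x| ≤ G) (hy : |y| ≤ N) : |x * y| ≤ G * N := by
  rw [abs_mul]
  exact mul_le_mul hx hy (abs_nonneg _) ((abs_nonneg _).trans hx)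

lemma part_two (h k : Fin 4 → Fin 4 → ℝ) (hs : ∀ a b, h a b = h b a)
    (ks : ∀ a b, k a b = k b a) (L M : Fin 4 → ℝ) (S : Fin 2 → E3)
    (he : ∀ a b, eta a b = -(1/2) * (L a * M b) + -(1/2) * (M a * L b)
      + spat (S 0) a * spat (S 0) b + spat (S 1) a * spat (S 1) b) :
    |Pform h k - PS S h k|
      ≤ 4 * (((|con2 h L L| + |con2 h L (spat (S 0))| + |con2 h L (spat (S 1))|) + |trS S h|)
            * (∑ U : Fin 4, ∑ V : Fin 4, |con2 k (![L, M, spat (S 0), spat (S 1)] U)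
                (![L, M, spat (S 0), spat (S 1)] V)|)
          + (∑ U : Fin 4, ∑ V : Fin 4, |con2 h (![L, M, spat (S 0), spat (S 1)] U)
                (![L, M, spat (S 0), spat (S 1)] V)|)
            * ((|con2 k L L| + |con2 k L (spat (S 0))| + |con2 k L (spat (S 1))|) + |trS S k|)) := by
  have bd : ∀ (f : Fin 4 → Fin 4 → ℝ) (U V : Fin 4),
      |con2 f (![L, M, spat (S 0), spat (S 1)] U) (![L, M, spat (S 0), spat (S 1)] V)| ≤
      ∑ U : Fin 4, ∑ V : Fin 4, |con2 f (![L, M, spat (S 0), spat (S 1)] U)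
                (![L, M, spat (S 0), spat (S 1)] V)| := fun f U V =>
    abs_entry_le_nMat (fun U V => con2 f (![L, M, spat (S 0), spat (S 1)] U)
                (![L, M, spat (S 0), spat (S 1)] V)) U V
  have gd : ∀ f : Fin 4 → Fin 4 → ℝ, ∃ G, G = (|con2 f L L| + |con2 f L (spat (S 0))|
      + |con2 f L (spat (S 1))|) + |trS S f| ∧ |con2 f L L| ≤ G ∧ |con2 f L (spat (S 0))| ≤ G ∧
      |con2 f L (spat (S 1))| ≤ G ∧ |trS S f| ≤ G := by
    intro f
    have h1 := abs_nonneg (con2 f L L)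
    have h2 := abs_nonneg (con2 f L (spat (S 0)))
    have h3 := abs_nonneg (con2 f L (spat (S 1)))
    have h4 := abs_nonneg (trS S f)
    exact ⟨_, rfl, by linarith, by linarith, by linarith, by linarith⟩
  have nd : ∀ f : Fin 4 → Fin 4 → ℝ, ∃ N, N = (∑ U : Fin 4, ∑ V : Fin 4,
      |con2 f (![L, M, spat (S 0), spat (S 1)] U) (![L, M, spat (S 0), spat (S 1)] V)|) ∧
      |con2 f L M| ≤ N ∧ |con2 f M M| ≤ N ∧ |con2 f M (spat (S 0))| ≤ N ∧
      |con2 f M (spat (S 1))| ≤ N := fun f =>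
    ⟨_, rfl, bd f 0 1, bd f 1 1, bd f 1 2, bd f 1 3⟩
  obtain ⟨G, eG, g1, g2, g3, g4⟩ := gd h
  obtain ⟨G', eG', g1', g2', g3', g4'⟩ := gd k
  obtain ⟨N, eN, n1, n2, n3, n4⟩ := nd h
  obtain ⟨N', eN', n1', n2', n3', n4'⟩ := nd k
  rw [← eG, ← eG', ← eN, ← eN']
  have id1 : Pform h k - PS S h k =
      -(1/4) * (trS S h * con2 k L M) - (1/4) * (con2 h L M * trS S k)
      - (1/8) * (con2 h L L * con2 k M M) - (1/8) * (con2 h M M * con2 k L L)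
      + (1/2) * (con2 h L (spat (S 0)) * con2 k M (spat (S 0)))
      + (1/2) * (con2 h M (spat (S 0)) * con2 k L (spat (S 0)))
      + (1/2) * (con2 h L (spat (S 1)) * con2 k M (spat (S 1)))
      + (1/2) * (con2 h M (spat (S 1)) * con2 k L (spat (S 1))) := by
    rw [Pform_frame h k hs ks L M _ _ he]
    simp only [PS, hatS, trS, Fin.sum_univ_two]
    rw [con2_comm h hs (spat (S 1)) (spat (S 0)), con2_comm k ks (spat (S 1)) (spat (S 0))]
    simp
    ring
  rw [id1]
  have t1 := abs_le.mp (abs_mul_le_of g4 n1')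
  have t2 := abs_le.mp (abs_mul_le_of n1 g4')
  have t3 := abs_le.mp (abs_mul_le_of g1 n2')
  have t4 := abs_le.mp (abs_mul_le_of n2 g1')
  have t5 := abs_le.mp (abs_mul_le_of g2 n3')
  have t6 := abs_le.mp (abs_mul_le_of n3 g2')
  have t7 := abs_le.mp (abs_mul_le_of g3 n4')
  have t8 := abs_le.mp (abs_mul_le_of n4 g3')
  rw [abs_le]
  constructor <;> linarith [t1.1, t1.2, t2.1, t2.2, t3.1, t3.2, t4.1, t4.2, t5.1, t5.2,
    t6.1, t6.2, t7.1, t7.2, t8.1, t8.2]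

/-- **Weak null structure of `P`** (estimates (eq:PPnull) and (eq:tanPsec3)). -/
theorem weak_null_structure_P :
    ∃ C : ℝ, 0 < C ∧
    ((∀ h k : Spt → Fin 4 → Fin 4 → ℝ,
        (∀ a b : Fin 4, ContDiff ℝ 1 (fun p => h p a b)) →
        (∀ a b : Fin 4, ContDiff ℝ 1 (fun p => k p a b)) →
        (∀ (p : Spt) (a b : Fin 4), h p a b = h p b a) →
        (∀ (p : Spt) (a b : Fin 4), k p a b = k p b a) →
        ∀ p : Spt, p.2 ≠ 0 → ∀ μ ν : Fin 4,
          |Pform (derMat h p (dir μ)) (derMat k p (dir ν))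
              - Llow p μ * Llow p ν * Pform (derMat h p (qdir p)) (derMat k p (qdir p))|
            ≤ C * (nT2 h p * nD2 k p + nD2 h p * nT2 k p)) ∧
     (∀ (x : E3), x ≠ 0 → ∀ S : Fin 2 → E3,
        (∀ A B : Fin 2, (inner ℝ (S A) (S B) : ℝ) = if A = B then 1 else 0) →
        (∀ A : Fin 2, (inner ℝ (S A) x : ℝ) = 0) →
        ∀ h k : Fin 4 → Fin 4 → ℝ,
        (∀ a b, h a b = h b a) → (∀ a b, k a b = k b a) →
        |Pform h k - PS S h k|
          ≤ C * (((|con2 h (Lup ((0:ℝ), x)) (Lup ((0:ℝ), x))|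
                  + |con2 h (Lup ((0:ℝ), x)) (spat (S 0))|
                  + |con2 h (Lup ((0:ℝ), x)) (spat (S 1))|) + |trS S h|)
                * (∑ U : Fin 4, ∑ V : Fin 4,
                    |con2 k (![Lup ((0:ℝ), x), Lbarup ((0:ℝ), x), spat (S 0), spat (S 1)] U)
                      (![Lup ((0:ℝ), x), Lbarup ((0:ℝ), x), spat (S 0), spat (S 1)] V)|)
              + (∑ U : Fin 4, ∑ V : Fin 4,
                    |con2 h (![Lup ((0:ℝ), x), Lbarup ((0:ℝ), x), spat (S 0), spat (S 1)] U)
                      (![Lup ((0:ℝ), x), Lbarup ((0:ℝ), x), spat (S 0), spat (S 1)] V)|)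
                * ((|con2 k (Lup ((0:ℝ), x)) (Lup ((0:ℝ), x))|
                  + |con2 k (Lup ((0:ℝ), x)) (spat (S 0))|
                  + |con2 k (Lup ((0:ℝ), x)) (spat (S 1))|) + |trS S k|)))) := by
  refine ⟨4, by norm_num, ?_, ?_⟩
  · intro h k _ _ _ _ p hp μ ν
    have h1 := part_one h k p hp μ ν
    have h2 := abs_nonneg (Pform (derMat h p (dir μ)) (derMat k p (dir ν))
        - Llow p μ * Llow p ν * Pform (derMat h p (qdir p)) (derMat k p (qdir p)))
    linarith
  · intro x hx S hS hSx h k hs ks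
    exact part_two h k hs ks _ _ S (eta_frame_s18 x hx S hS hSx)
end
end

section
/- There is an absolute constant C such that for every smooth symmetric contravariant 2-tensor field H^{αβ} on ℝ^{1+3}∖{r=0}, setting Ĥ^{αβ} = H^{αβ} − ½m^{αβ}m_{γδ}H^{γδ}, the pointwise estimate |∂_qH|_{L𝒯} + |∂_q tr̸H| ≤ C( |∂̄H| + Σ_{ν} |∂_μĤ^{μν}| ) holds, where |∂_qH|_{L𝒯} = Σ_{T∈𝒯} |L_αT_β ∂_qH^{αβ}|, |∂_q tr̸H| = |Σ_{A∈{S₁,S₂}} S_{Aα}S_{Aβ} ∂_qH^{αβ}|, and |∂̄H| is the sum over components of the tangential derivatives of H. -/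
noncomputable section
open MeasureTheory

/-- Trace reversal `Ĥ^{αβ} = H^{αβ} - ½ m^{αβ} m_{γδ} H^{γδ}`. -/
def traceRev (H : Spt → Fin 4 → Fin 4 → ℝ) (p : Spt) (a b : Fin 4) : ℝ :=
  H p a b - (1/2) * eta a b * (∑ c : Fin 4, ∑ d : Fin 4, eta c d * H p c d)

/-- `∂_q` derivative of a component. -/
def dq (H : Spt → Fin 4 → Fin 4 → ℝ) (p : Spt) (a b : Fin 4) : ℝ :=
  fderiv ℝ (fun q => H q a b) p (qdir p)

lemma wc_frame (w s0 s1 : E3) (hw : (inner ℝ w w : ℝ) = 1) (h00 : (inner ℝ s0 s0 : ℝ) = 1)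
    (h11 : (inner ℝ s1 s1 : ℝ) = 1) (h01 : (inner ℝ s0 s1 : ℝ) = 0)
    (h0w : (inner ℝ s0 w : ℝ) = 0) (h1w : (inner ℝ s1 w : ℝ) = 0) (i j : Fin 3) :
    w i * w j + s0 i * s0 j + s1 i * s1 j = if i = j then 1 else 0 := by
  have key : (!![w 0, w 1, w 2; s0 0, s0 1, s0 2; s1 0, s1 1, s1 2] : Matrix (Fin 3) (Fin 3) ℝ) *
      !![w 0, s0 0, s1 0; w 1, s0 1, s1 1; w 2, s0 2, s1 2] = 1 := by
    simp only [PiLp.inner_apply, RCLike.inner_apply, conj_trivial, Fin.sum_univ_three] at *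
    ext a b
    fin_cases a <;> fin_cases b <;>
      simp [Matrix.mul_apply, Fin.sum_univ_three] <;> linarith
  have key2 := mul_eq_one_comm.mp key
  have := congrFun (congrFun key2 i) j
  rw [Matrix.one_apply] at this
  rw [← this]
  fin_cases i <;> fin_cases j <;> simp [Matrix.mul_apply, Fin.sum_univ_three]

lemma wc_coord_le (s : E3) (h : (inner ℝ s s : ℝ) = 1) (i : Fin 3) : |s i| ≤ 1 := by
  simp only [PiLp.inner_apply, RCLike.inner_apply, conj_trivial, Fin.sum_univ_three] at h
  rw [← sq_le_one_iff_abs_le_one]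
  fin_cases i <;> dsimp only [Fin.zero_eta, Fin.mk_one, Fin.reduceFinMk] <;> nlinarith [sq_nonneg (s 0), sq_nonneg (s 1), sq_nonneg (s 2)]

/-- Algebraic trace reversal. -/
def wcRev (Q : Fin 4 → Fin 4 → ℝ) (a b : Fin 4) : ℝ :=
  Q a b - (1/2) * eta a b * (∑ c : Fin 4, ∑ d : Fin 4, eta c d * Q c d)

lemma wc_rev_le (Q : Fin 4 → Fin 4 → ℝ) (M : ℝ)
    (hM : ∑ a : Fin 4, ∑ b : Fin 4, |Q a b| ≤ M) (a b : Fin 4) : |wcRev Q a b| ≤ 2 * M := by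
  have he : ∀ a b, |eta a b| ≤ 1 := by
    intro a b; unfold eta; split_ifs <;> simp
  have h1 : |Q a b| ≤ M := by
    refine le_trans ?_ hM
    refine le_trans ?_ (Finset.single_le_sum (f := fun a => ∑ b : Fin 4, |Q a b|)
      (fun i _ => Finset.sum_nonneg fun _ _ => abs_nonneg _) (Finset.mem_univ a))
    exact Finset.single_le_sum (f := fun b => |Q a b|) (fun i _ => abs_nonneg _)
      (Finset.mem_univ b)
  have h2 : |∑ c : Fin 4, ∑ d : Fin 4, eta c d * Q c d| ≤ M := by
    refine le_trans ?_ hM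
    refine (Finset.abs_sum_le_sum_abs _ _).trans (Finset.sum_le_sum fun c _ => ?_)
    refine (Finset.abs_sum_le_sum_abs _ _).trans (Finset.sum_le_sum fun d _ => ?_)
    rw [abs_mul]
    exact mul_le_of_le_one_left (abs_nonneg _) (he c d)
  have h0 : 0 ≤ M := (abs_nonneg _).trans h1
  have h3 : |(1/2) * eta a b * (∑ c : Fin 4, ∑ d : Fin 4, eta c d * Q c d)| ≤ M := by
    rw [abs_mul, abs_mul]
    have : |(1/2:ℝ)| * |eta a b| ≤ 1 := by
      have := he a b
      rw [abs_of_pos (by norm_num)]; linarith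
    calc _ ≤ 1 * |∑ c : Fin 4, ∑ d : Fin 4, eta c d * Q c d| := by gcongr
      _ ≤ M := by linarith
  unfold wcRev
  refine (abs_sub _ _).trans ?_
  linarith

lemma wc_contract (V G : Fin 4 → ℝ) (K : ℝ) (hV : ∀ a, |V a| ≤ 1) (hG : ∀ a, |G a| ≤ K) :
    |∑ a, V a * G a| ≤ 4 * K := by
  refine (Finset.abs_sum_le_sum_abs _ _).trans ?_
  have : ∀ a ∈ (Finset.univ : Finset (Fin 4)), |V a * G a| ≤ K := by
    intro a _
    rw [abs_mul]
    exact (mul_le_of_le_one_left (abs_nonneg _) (hV a)).trans (hG a)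
  refine (Finset.sum_le_sum this).trans ?_
  simp

lemma wc_LT (p : Spt) (Q : Fin 4 → Fin 4 → ℝ) (V : Fin 4 → ℝ)
    (hV : -(Llow p 0 * V 0) + Llow p 1 * V 1 + Llow p 2 * V 2 + Llow p 3 * V 3 = 0) :
    ∑ a : Fin 4, ∑ b : Fin 4, Llow p a * V b * Q a b
      = ∑ b, V b * ∑ a, Llow p a * wcRev Q a b := by
  have : ∀ T : ℝ, (∑ b, V b * ∑ a, Llow p a * (Q a b - (1/2) * eta a b * T))
      = ∑ a : Fin 4, ∑ b : Fin 4, Llow p a * V b * Q a b := by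
    intro T
    simp only [Fin.sum_univ_four, eta]
    simp
    linear_combination (-(1/2) * T) * hV
  exact (this _).symm

lemma wc_tr (p : Spt) (hw : (omg p 0)^2 + (omg p 1)^2 + (omg p 2)^2 = 1)
    (Q : Fin 4 → Fin 4 → ℝ) (hQ : ∀ a b, Q a b = Q b a) (S : Fin 2 → E3)
    (hS : ∀ i j : Fin 3, omg p i * omg p j + S 0 i * S 0 j + S 1 i * S 1 j
      = if i = j then 1 else 0) :
    ∑ A : Fin 2, ∑ a : Fin 4, ∑ b : Fin 4, spat (S A) a * spat (S A) b * Q a b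
      = ∑ b, Lbarlow p b * ∑ a, Llow p a * wcRev Q a b := by
  have e : ∀ a b, spat (S 0) a * spat (S 0) b + spat (S 1) a * spat (S 1) b
      = eta a b + 1/2 * (Llow p a * Lbarlow p b + Lbarlow p a * Llow p b) := by
    intro a b
    refine Fin.cases ?_ (fun i => ?_) a <;> refine Fin.cases ?_ (fun j => ?_) b <;>
      simp [spat, eta, Llow, Lbarlow]
    · norm_num
    · exact fun h => absurd h (Fin.succ_ne_zero j).symm
    · have := hS i j
      linarith
  have hLL : -(Llow p 0 * Lbarlow p 0) + Llow p 1 * Lbarlow p 1 + Llow p 2 * Lbarlow p 2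
      + Llow p 3 * Lbarlow p 3 = -2 := by
    change -((-1:ℝ) * (-1)) + omg p 0 * -(omg p 0) + omg p 1 * -(omg p 1)
      + omg p 2 * -(omg p 2) = -2
    linarith
  have l1 : ∑ A : Fin 2, ∑ a : Fin 4, ∑ b : Fin 4, spat (S A) a * spat (S A) b * Q a b
      = ∑ a : Fin 4, ∑ b : Fin 4,
        (eta a b + 1/2 * (Llow p a * Lbarlow p b + Lbarlow p a * Llow p b)) * Q a b := by
    rw [Fin.sum_univ_two, ← Finset.sum_add_distrib]
    refine Finset.sum_congr rfl fun a _ => ?_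
    rw [← Finset.sum_add_distrib]
    refine Finset.sum_congr rfl fun b _ => ?_
    rw [← e]; ring
  rw [l1]
  have l2 : ∀ T : ℝ, (∑ b, Lbarlow p b * ∑ a, Llow p a * (Q a b - (1/2) * eta a b * T))
      = (∑ a : Fin 4, ∑ b : Fin 4, Lbarlow p b * Llow p a * Q a b) + T := by
    intro T
    simp only [Fin.sum_univ_four, eta]
    simp
    linear_combination (-(1/2) * T) * hLL
  have l3 : ∑ a : Fin 4, ∑ b : Fin 4, Lbarlow p b * Llow p a * Q a b
      = ∑ a : Fin 4, ∑ b : Fin 4, Lbarlow p a * Llow p b * Q a b := by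
    rw [Finset.sum_comm]
    refine Finset.sum_congr rfl fun a _ => Finset.sum_congr rfl fun b _ => ?_
    rw [hQ a b]
  refine Eq.trans ?_ (l2 _).symm
  have l4 : ∑ a : Fin 4, ∑ b : Fin 4,
        (eta a b + 1/2 * (Llow p a * Lbarlow p b + Lbarlow p a * Llow p b)) * Q a b
      = 1/2 * (∑ a : Fin 4, ∑ b : Fin 4, Lbarlow p b * Llow p a * Q a b)
        + 1/2 * (∑ a : Fin 4, ∑ b : Fin 4, Lbarlow p a * Llow p b * Q a b)
        + ∑ a : Fin 4, ∑ b : Fin 4, eta a b * Q a b := by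
    simp only [Finset.mul_sum, ← Finset.sum_add_distrib]
    refine Finset.sum_congr rfl fun a _ => Finset.sum_congr rfl fun b _ => ?_
    ring
  rw [l4, ← l3]; ring

lemma wc_pd (H : Spt → Fin 4 → Fin 4 → ℝ) (p : Spt)
    (hd : ∀ a b : Fin 4, DifferentiableAt ℝ (fun q => H q a b) p) (m a b : Fin 4) :
    pd m (fun q => traceRev H q a b) p
      = wcRev (fun a b => fderiv ℝ (fun q => H q a b) p (dir m)) a b := by
  have h : HasFDerivAt (fun q => traceRev H q a b)
      (fderiv ℝ (fun q => H q a b) p - ((1/2) * eta a b) •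
        (∑ c : Fin 4, ∑ d : Fin 4, eta c d • fderiv ℝ (fun q => H q c d) p)) p := by
    unfold traceRev
    refine (hd a b).hasFDerivAt.sub (HasFDerivAt.const_mul ?_ _)
    refine HasFDerivAt.fun_sum fun c _ => HasFDerivAt.fun_sum fun d _ => ?_
    exact (hd c d).hasFDerivAt.const_mul _
  unfold pd
  rw [h.fderiv]
  simp [wcRev]

/-- Coefficients of `L` in the coordinate derivatives. -/
def wcC (p : Spt) (a : Fin 4) : ℝ := Fin.cases (1/2:ℝ) (fun i => omg p i / 2) a

lemma wc_dir (p : Spt) (S : Fin 2 → E3)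
    (hS : ∀ i j : Fin 3, omg p i * omg p j + S 0 i * S 0 j + S 1 i * S 1 j
      = if i = j then 1 else 0) (m : Fin 4) :
    dir m = Llow p m • qdir p + wcC p m • Ldir p
      + spat (S 0) m • ((0:ℝ), S 0) + spat (S 1) m • ((0:ℝ), S 1) := by
  refine Fin.cases ?_ (fun i => ?_) m
  · refine Prod.ext ?_ ?_
    · simp [dir, Llow, qdir, wcC, Ldir, spat]; norm_num
    · ext j
      simp [dir, Llow, qdir, wcC, Ldir, spat]
  · refine Prod.ext ?_ ?_
    · simp [dir, Llow, qdir, wcC, Ldir, spat]; ring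
    · ext j
      have := hS i j
      simp [dir, Llow, qdir, wcC, Ldir, spat, eq_comm (a := j)]
      rw [← this]; ring

lemma wc_rev_lin (Q R D0 D1 : Fin 4 → Fin 4 → ℝ) (x y z u : ℝ) (a b : Fin 4) :
    wcRev (fun a b => x * Q a b + y * R a b + z * D0 a b + u * D1 a b) a b
      = x * wcRev Q a b + y * wcRev R a b + z * wcRev D0 a b + u * wcRev D1 a b := by
  have : ∑ c : Fin 4, ∑ d : Fin 4, eta c d * (x * Q c d + y * R c d + z * D0 c d + u * D1 c d)
      = x * (∑ c : Fin 4, ∑ d : Fin 4, eta c d * Q c d)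
        + y * (∑ c : Fin 4, ∑ d : Fin 4, eta c d * R c d)
        + z * (∑ c : Fin 4, ∑ d : Fin 4, eta c d * D0 c d)
        + u * (∑ c : Fin 4, ∑ d : Fin 4, eta c d * D1 c d) := by
    simp only [Finset.mul_sum, ← Finset.sum_add_distrib]
    refine Finset.sum_congr rfl fun a _ => Finset.sum_congr rfl fun b _ => ?_
    ring
  unfold wcRev
  rw [this]; ring

/-- **The wave-coordinate-condition estimate** ((eq:firstwavecoordinateestimate)): there is an
absolute constant `C` such that for any `C¹` symmetric (2,0)-tensor `H` away from `r = 0`,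
`|∂_q H|_{L𝒯} + |∂_q tr̸H| ≤ C (|∂̄H| + Σ_ν |∂_μ Ĥ^{μν}|)`. -/
theorem wave_coordinate_condition_estimate :
    ∃ C : ℝ, 0 < C ∧
    ∀ H : Spt → Fin 4 → Fin 4 → ℝ,
      (∀ (p : Spt) (a b : Fin 4), H p a b = H p b a) →
      ∀ p : Spt, p.2 ≠ 0 →
      (∀ a b : Fin 4, DifferentiableAt ℝ (fun q => H q a b) p) →
      ∀ S : Fin 2 → E3,
        (∀ A B : Fin 2, (inner ℝ (S A) (S B) : ℝ) = if A = B then 1 else 0) →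
        (∀ A : Fin 2, (inner ℝ (S A) p.2 : ℝ) = 0) →
        -- |∂_q H|_{L𝒯}
        (|∑ a : Fin 4, ∑ b : Fin 4, Llow p a * Llow p b * dq H p a b|
          + |∑ a : Fin 4, ∑ b : Fin 4, Llow p a * spat (S 0) b * dq H p a b|
          + |∑ a : Fin 4, ∑ b : Fin 4, Llow p a * spat (S 1) b * dq H p a b|)
        -- |∂_q tr̸H|
        + |∑ A : Fin 2, ∑ a : Fin 4, ∑ b : Fin 4, spat (S A) a * spat (S A) b * dq H p a b|
        ≤ C * (
          -- |∂̄H| : tangential derivatives of all components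
          (∑ a : Fin 4, ∑ b : Fin 4,
            (|fderiv ℝ (fun q => H q a b) p (Ldir p)|
              + ∑ A : Fin 2, |fderiv ℝ (fun q => H q a b) p ((0:ℝ), S A)|))
          -- Σ_ν |∂_μ Ĥ^{μν}|
          + ∑ ν : Fin 4, |∑ μ : Fin 4, pd μ (fun q => traceRev H q μ ν) p|) := by
  refine ⟨400, by norm_num, ?_⟩
  intro H hsym p hp hd S hSS hSp
  have hn : ‖p.2‖ ≠ 0 := norm_ne_zero_iff.mpr hp
  have hww : (inner ℝ (omg p) (omg p) : ℝ) = 1 := by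
    rw [omg, real_inner_smul_left, real_inner_smul_right, real_inner_self_eq_norm_sq]
    field_simp
  have hSw : ∀ A, (inner ℝ (S A) (omg p) : ℝ) = 0 := by
    intro A
    rw [omg, real_inner_smul_right, hSp A, mul_zero]
  have hS1 : ∀ A, (inner ℝ (S A) (S A) : ℝ) = 1 := fun A => by simpa using hSS A A
  have hS01 : (inner ℝ (S 0) (S 1) : ℝ) = 0 := by simpa using hSS 0 1
  have hF := wc_frame (omg p) (S 0) (S 1) hww (hS1 0) (hS1 1) hS01 (hSw 0) (hSw 1)
  have bw := wc_coord_le _ hww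
  have bS := fun A => wc_coord_le _ (hS1 A)
  have hw2 : (omg p 0)^2 + (omg p 1)^2 + (omg p 2)^2 = 1 := by
    have := hww
    simp only [PiLp.inner_apply, RCLike.inner_apply, conj_trivial, Fin.sum_univ_three] at this
    linarith
  have bL : ∀ a, |Llow p a| ≤ 1 := by
    intro a; refine Fin.cases ?_ (fun i => ?_) a
    · simp [Llow]
    · simpa [Llow] using bw i
  have bLb : ∀ a, |Lbarlow p a| ≤ 1 := by
    intro a; refine Fin.cases ?_ (fun i => ?_) a
    · simp [Lbarlow]
    · simpa [Lbarlow] using bw i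
  have bC : ∀ a, |wcC p a| ≤ 1 := by
    intro a; refine Fin.cases ?_ (fun i => ?_) a
    · change |(1/2:ℝ)| ≤ 1
      rw [abs_of_pos] <;> norm_num
    · change |omg p i / 2| ≤ 1
      have := bw i
      rw [abs_div, abs_two]; linarith
  have bSp : ∀ A a, |spat (S A) a| ≤ 1 := by
    intro A a; refine Fin.cases ?_ (fun i => ?_) a
    · simp [spat]
    · simpa [spat] using bS A i
  have hLS : ∀ A, -(Llow p 0 * spat (S A) 0) + Llow p 1 * spat (S A) 1
      + Llow p 2 * spat (S A) 2 + Llow p 3 * spat (S A) 3 = 0 := by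
    intro A
    have := hSw A
    simp only [PiLp.inner_apply, RCLike.inner_apply, conj_trivial, Fin.sum_univ_three] at this
    change -((-1:ℝ) * 0) + omg p 0 * S A 0 + omg p 1 * S A 1 + omg p 2 * S A 2 = 0
    linarith
  have hLL : -(Llow p 0 * Llow p 0) + Llow p 1 * Llow p 1
      + Llow p 2 * Llow p 2 + Llow p 3 * Llow p 3 = 0 := by
    change -((-1:ℝ) * (-1)) + omg p 0 * omg p 0 + omg p 1 * omg p 1 + omg p 2 * omg p 2 = 0
    linarith
  have hQ : ∀ a b, dq H p a b = dq H p b a := by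
    intro a b
    unfold dq
    rw [show (fun q => H q a b) = (fun q => H q b a) from funext fun q => hsym q a b]
  rw [wc_LT p (dq H p) _ hLL, wc_LT p (dq H p) _ (hLS 0), wc_LT p (dq H p) _ (hLS 1),
    wc_tr p hw2 (dq H p) hQ S hF]
  set R : Fin 4 → Fin 4 → ℝ := fun a b => fderiv ℝ (fun q => H q a b) p (Ldir p) with hR
  set D : Fin 2 → Fin 4 → Fin 4 → ℝ :=
    fun A a b => fderiv ℝ (fun q => H q a b) p ((0:ℝ), S A) with hD
  have hdiv : ∀ ν, ∑ μ : Fin 4, pd μ (fun q => traceRev H q μ ν) p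
      = (∑ μ, Llow p μ * wcRev (dq H p) μ ν) + (∑ μ, wcC p μ * wcRev R μ ν)
        + (∑ μ, spat (S 0) μ * wcRev (D 0) μ ν) + (∑ μ, spat (S 1) μ * wcRev (D 1) μ ν) := by
    intro ν
    simp only [← Finset.sum_add_distrib]
    refine Finset.sum_congr rfl fun μ _ => ?_
    rw [wc_pd H p hd, ← wc_rev_lin]
    congr 1
    funext a b
    rw [wc_dir p S hF μ]
    simp only [map_add, map_smul, smul_eq_mul]
    rfl
  set M : ℝ := (∑ a : Fin 4, ∑ b : Fin 4,
            (|fderiv ℝ (fun q => H q a b) p (Ldir p)|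
              + ∑ A : Fin 2, |fderiv ℝ (fun q => H q a b) p ((0:ℝ), S A)|))
          + ∑ ν : Fin 4, |∑ μ : Fin 4, pd μ (fun q => traceRev H q μ ν) p| with hM
  have hdn : 0 ≤ ∑ ν : Fin 4, |∑ μ : Fin 4, pd μ (fun q => traceRev H q μ ν) p| :=
    Finset.sum_nonneg fun _ _ => abs_nonneg _
  have hn : ∀ Q : Fin 4 → Fin 4 → ℝ, 0 ≤ ∑ a : Fin 4, ∑ b : Fin 4, |Q a b| :=
    fun Q => Finset.sum_nonneg fun _ _ => Finset.sum_nonneg fun _ _ => abs_nonneg _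
  have hMs : M = (∑ a : Fin 4, ∑ b : Fin 4, |R a b|) + (∑ a : Fin 4, ∑ b : Fin 4, |D 0 a b|)
      + (∑ a : Fin 4, ∑ b : Fin 4, |D 1 a b|)
      + ∑ ν : Fin 4, |∑ μ : Fin 4, pd μ (fun q => traceRev H q μ ν) p| := by
    rw [hM]
    congr 1
    simp only [← Finset.sum_add_distrib]
    refine Finset.sum_congr rfl fun a _ => Finset.sum_congr rfl fun b _ => ?_
    rw [Fin.sum_univ_two, ← add_assoc]
  have n1 := hn R
  have n2 := hn (D 0)
  have n3 := hn (D 1)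
  have r1 := wc_rev_le R M (by linarith)
  have r2 := wc_rev_le (D 0) M (by linarith)
  have r3 := wc_rev_le (D 1) M (by linarith)
  have hG : ∀ ν, |∑ μ, Llow p μ * wcRev (dq H p) μ ν| ≤ 25 * M := by
    intro ν
    have d1 := wc_contract (wcC p) (fun μ => wcRev R μ ν) _ bC (fun μ => r1 μ ν)
    have d2 := wc_contract (spat (S 0)) (fun μ => wcRev (D 0) μ ν) _ (bSp 0) (fun μ => r2 μ ν)
    have d3 := wc_contract (spat (S 1)) (fun μ => wcRev (D 1) μ ν) _ (bSp 1) (fun μ => r3 μ ν)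
    have d4 : |∑ μ : Fin 4, pd μ (fun q => traceRev H q μ ν) p| ≤ M := by
      have := Finset.single_le_sum
        (f := fun ν => |∑ μ : Fin 4, pd μ (fun q => traceRev H q μ ν) p|)
        (fun i _ => abs_nonneg _) (Finset.mem_univ ν)
      linarith
    rw [hdiv ν] at d4
    simp only [abs_le] at *
    constructor <;> linarith [d1.1, d1.2, d2.1, d2.2, d3.1, d3.2, d4.1, d4.2]
  have e1 := wc_contract (Llow p) _ _ bL hG
  have e2 := wc_contract (spat (S 0)) _ _ (bSp 0) hG
  have e3 := wc_contract (spat (S 1)) _ _ (bSp 1) hG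
  have e4 := wc_contract (Lbarlow p) _ _ bLb hG
  linarith
end
end
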